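/- arXiv:1002.1229 — 2 statements merged into one kernel-verified Lean document; each statement's English description precedes it below -/
import Mathlib

section
/- d_1 = 1 and, for every i ≥ 2, d_i = c_{i−2} + Σ_{j=1}^{i−1} d_j, where c_i is the number of featureless Schröder prefixes in 𝒟 terminating at (i,i) and d_i is the number of featureless Schröder prefixes in 𝒟 terminating at (i−1,i). (Indeed, (i−1,i) can be reached within D̃ only by an n step preceded by a d step, giving c_{i−2} prefixes, or via the steps n^{i−j} e^{i−j} from height j, giving d_j prefixes for each j = 1,…,i−1.) -/
/-- A step of a lattice path: `E = (1,0)`, `N = (0,1)`, `D = (1,1)`. -/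
inductive Step : Type
  | E : Step
  | N : Step
  | D : Step
  deriving DecidableEq

/-- The x-coordinate of the lattice point reached after performing the steps `q`
(starting from the origin). -/
def posX (q : List Step) : ℕ := q.count Step.E + q.count Step.D

/-- The y-coordinate of the lattice point reached after performing the steps `q`
(starting from the origin). -/
def posY (q : List Step) : ℕ := q.count Step.N + q.count Step.D

/-- A Schröder prefix: a lattice path starting at the origin which never passes
below the line `y = x`. -/
def IsSchroderPrefix (p : List Step) : Prop :=
  ∀ q : List Step, q <+: p → posX q ≤ posY q

/-- A Schröder path of length `n`: a Schröder prefix terminating at `(n, n)`. -/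
def IsSchroderPath (n : ℕ) (p : List Step) : Prop :=
  IsSchroderPrefix p ∧ posX p = n ∧ posY p = n

/-- Interchange `E` and `N` steps. -/
def revStep : Step → Step
  | Step.E => Step.N
  | Step.N => Step.E
  | Step.D => Step.D

/-- The reversal of a Schröder path: write the steps in reverse order and
interchange `E` and `N` steps. -/
def revPath (p : List Step) : List Step := p.reverse.map revStep

/-- Words which are concatenations of blocks, each block being a single `D` step or
of the form `N^k E^k` for some `k > 0`. -/
inductive IsInnerWord : List Step → Prop
  | nil : IsInnerWord []
  | dcons {p : List Step} : IsInnerWord p → IsInnerWord (Step.D :: p)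
  | peak {k : ℕ} {p : List Step} : 0 < k → IsInnerWord p →
      IsInnerWord (List.replicate k Step.N ++ List.replicate k Step.E ++ p)

/-- Words which are concatenations of blocks, each block being a single `D` step or of
the form `N q E` where `q` is an inner word. -/
inductive IsDWord : List Step → Prop
  | nil : IsDWord []
  | dcons {p : List Step} : IsDWord p → IsDWord (Step.D :: p)
  | block {q p : List Step} : IsInnerWord q → IsDWord p →
      IsDWord (Step.N :: (q ++ Step.E :: p))

/-- Membership in `𝒟_n`: a Schröder path of length `n` of the prescribed block form. -/
def MemD (n : ℕ) (p : List Step) : Prop := IsDWord p ∧ IsSchroderPath n p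

/-- Membership in `𝒟`: Schröder prefixes occurring as initial segments of some
path in `𝒟_m` for some finite `m`. -/
def MemCalD (p : List Step) : Prop := ∃ (m : ℕ) (q : List Step), p <+: q ∧ MemD m q

/-- `p` has a level feature at `t`: a `D` step joining `(t-1, t)` to `(t, t+1)`. -/
def HasLevelFeatureAt (p : List Step) (t : ℕ) : Prop :=
  1 ≤ t ∧ ∃ q r : List Step, p = q ++ Step.D :: r ∧ posX q = t - 1 ∧ posY q = t

/-- `p` has a notch feature at `t`: an `E` step joining `(t-1, t)` to `(t, t)`
immediately followed by an `N` step joining `(t, t)` to `(t, t+1)`. -/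
def HasNotchFeatureAt (p : List Step) (t : ℕ) : Prop :=
  1 ≤ t ∧ ∃ q r : List Step, p = q ++ Step.E :: Step.N :: r ∧ posX q = t - 1 ∧ posY q = t

/-- `p` has no (level or notch) features. -/
def Featureless (p : List Step) : Prop :=
  ∀ t : ℕ, ¬ HasLevelFeatureAt p t ∧ ¬ HasNotchFeatureAt p t

/-- Auxiliary function for `psi`, processing the path left to right while keeping track of
the current height `y - x` above the diagonal: at height `1`, a `D` step (a level feature)
is replaced by `E N` (a notch feature) and vice versa; all other steps are unchanged. -/
def psiAux : ℕ → List Step → List Step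
  | 1, Step.D :: rest => Step.E :: Step.N :: psiAux 1 rest
  | 1, Step.E :: Step.N :: rest => Step.D :: psiAux 1 rest
  | h, Step.N :: rest => Step.N :: psiAux (h + 1) rest
  | h, Step.E :: rest => Step.E :: psiAux (h - 1) rest
  | h, Step.D :: rest => Step.D :: psiAux h rest
  | _, [] => []
  termination_by h l => l.length

/-- `psi p` replaces every level feature of `p` by a notch feature at the same place and
vice versa, leaving all other steps unchanged. -/
def psi (p : List Step) : List Step := psiAux 0 p

/-- `a i`: the number of Schröder prefixes in `𝒟` terminating at `(i, i)`. -/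
noncomputable def aSeq (i : ℕ) : ℕ :=
  Set.ncard {p : List Step | MemCalD p ∧ posX p = i ∧ posY p = i}

/-- `b i`: the number of Schröder prefixes in `𝒟` terminating at `(i-1, i)` (and `b 0 = 0`). -/
noncomputable def bSeq (i : ℕ) : ℕ :=
  Set.ncard {p : List Step | MemCalD p ∧ posX p + 1 = i ∧ posY p = i}

/-- `c i`: the number of featureless Schröder prefixes in `𝒟` terminating at `(i, i)`. -/
noncomputable def cSeq (i : ℕ) : ℕ :=
  Set.ncard {p : List Step | MemCalD p ∧ Featureless p ∧ posX p = i ∧ posY p = i}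

/-- `d i`: the number of featureless Schröder prefixes in `𝒟` terminating at `(i-1, i)`
(and `d 0 = 0`). -/
noncomputable def dSeq (i : ℕ) : ℕ :=
  Set.ncard {p : List Step | MemCalD p ∧ Featureless p ∧ posX p + 1 = i ∧ posY p = i}

/-- The permutation `π` (of `{1, …, n}`, 0-indexed as `Fin n`) contains the pattern `τ`
(a permutation of `{1, …, k}`, 0-indexed as `Fin k`). -/
def Contains {n k : ℕ} (π : Equiv.Perm (Fin n)) (τ : Equiv.Perm (Fin k)) : Prop :=
  ∃ f : Fin k → Fin n, StrictMono f ∧ ∀ a b : Fin k, τ a < τ b ↔ π (f a) < π (f b)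

/-- The permutation `π` avoids the pattern `τ`. -/
def Avoids {n k : ℕ} (π : Equiv.Perm (Fin n)) (τ : Equiv.Perm (Fin k)) : Prop :=
  ¬ Contains π τ

/-- The reverse-complement of a permutation: `rc π (i) = (n+1) - π (n+1-i)` (1-indexed),
i.e. `rc π (i) = rev (π (rev i))` in 0-indexed form. -/
def rc {n : ℕ} (π : Equiv.Perm (Fin n)) : Equiv.Perm (Fin n) :=
  (Fin.revPerm.trans π).trans Fin.revPerm

/-- The pattern `1243` (0-indexed: `0 ↦ 0, 1 ↦ 1, 2 ↦ 3, 3 ↦ 2`). -/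
def pat1243 : Equiv.Perm (Fin 4) := Equiv.swap 2 3

/-- The pattern `2143` (0-indexed: `0 ↦ 1, 1 ↦ 0, 2 ↦ 3, 3 ↦ 2`). -/
def pat2143 : Equiv.Perm (Fin 4) := Equiv.swap 0 1 * Equiv.swap 2 3

/-- The pattern `2134` (0-indexed: `0 ↦ 1, 1 ↦ 0, 2 ↦ 2, 3 ↦ 3`). -/
def pat2134 : Equiv.Perm (Fin 4) := Equiv.swap 0 1

@[simp] lemma posX_nil : posX [] = 0 := rfl
@[simp] lemma posY_nil : posY [] = 0 := rfl
@[simp] lemma posX_append (a b : List Step) : posX (a ++ b) = posX a + posX b := by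
  simp [posX, List.count_append]; omega
@[simp] lemma posY_append (a b : List Step) : posY (a ++ b) = posY a + posY b := by
  simp [posY, List.count_append]; omega
@[simp] lemma posX_E (a : List Step) : posX (Step.E :: a) = posX a + 1 := by
  simp [posX]; omega
@[simp] lemma posX_N (a : List Step) : posX (Step.N :: a) = posX a := by
  simp [posX]
@[simp] lemma posX_D (a : List Step) : posX (Step.D :: a) = posX a + 1 := by
  simp [posX]; omega
@[simp] lemma posY_E (a : List Step) : posY (Step.E :: a) = posY a := by
  simp [posY]
@[simp] lemma posY_N (a : List Step) : posY (Step.N :: a) = posY a + 1 := by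
  simp [posY]; omega
@[simp] lemma posY_D (a : List Step) : posY (Step.D :: a) = posY a + 1 := by
  simp [posY]; omega
@[simp] lemma posX_repN (k : ℕ) : posX (List.replicate k Step.N) = 0 := by
  simp [posX, List.count_replicate]
@[simp] lemma posY_repN (k : ℕ) : posY (List.replicate k Step.N) = k := by
  simp [posY, List.count_replicate]
@[simp] lemma posX_repE (k : ℕ) : posX (List.replicate k Step.E) = k := by
  simp [posX, List.count_replicate]
@[simp] lemma posY_repE (k : ℕ) : posY (List.replicate k Step.E) = 0 := by
  simp [posY, List.count_replicate]

lemma length_le_pos (p : List Step) : p.length ≤ posX p + posY p := by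
  induction p with
  | nil => simp
  | cons a t ih => cases a <;> simp <;> omega

lemma prefix_split {l a b : List Step} (h : l <+: a ++ b) :
    l <+: a ∨ ∃ c, l = a ++ c ∧ c <+: b := by
  obtain ⟨t, ht⟩ := h
  rcases List.append_eq_append_iff.1 ht with ⟨c, h1, h2⟩ | ⟨c, h1, h2⟩
  · exact Or.inl ⟨c, h1.symm⟩
  · exact Or.inr ⟨c, h1, ⟨t, h2.symm⟩⟩

lemma prefix_rep {l : List Step} {k : ℕ} {x : Step} (h : l <+: List.replicate k x) :
    ∃ j, j ≤ k ∧ l = List.replicate j x := by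
  rw [List.prefix_iff_eq_take] at h
  rw [List.take_replicate] at h
  exact ⟨_, min_le_right _ _, h⟩

lemma inner_bal {q : List Step} (h : IsInnerWord q) : posX q = posY q := by
  induction h with
  | nil => simp
  | dcons _ ih => simp [ih]
  | peak _ _ ih => simp [ih]

lemma dword_bal {q : List Step} (h : IsDWord q) : posX q = posY q := by
  induction h with
  | nil => simp
  | dcons _ ih => simp [ih]
  | block hq _ ih => have := inner_bal hq; simp [ih]; omega

lemma inner_append {q r : List Step} (h : IsInnerWord q) (hr : IsInnerWord r) :
    IsInnerWord (q ++ r) := by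
  induction h with
  | nil => simpa
  | dcons _ ih => exact .dcons ih
  | peak hk _ ih => rw [List.append_assoc]; exact .peak hk ih

lemma dword_append {q r : List Step} (h : IsDWord q) (hr : IsDWord r) :
    IsDWord (q ++ r) := by
  induction h with
  | nil => simpa
  | dcons _ ih => exact .dcons ih
  | block hq _ ih => 
    rw [List.cons_append, List.append_assoc, List.cons_append]; exact .block hq ih

lemma inner_prefix {q : List Step} (h : IsInnerWord q) : ∀ l, l <+: q →
    posX l ≤ posY l ∧ (posX l = posY l → IsInnerWord l) := by
  induction h with
  | nil => intro l hl; simp at hl; subst hl; simp [IsInnerWord.nil]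
  | dcons _ ih =>
    intro l hl
    rcases List.prefix_cons_iff.1 hl with rfl | ⟨t, rfl, ht⟩
    · simp [IsInnerWord.nil]
    · have := ih t ht
      refine ⟨by simp; omega, fun h => .dcons (this.2 (by simpa using h))⟩
  | @peak k p hk _ ih =>
    intro l hl
    rcases prefix_split hl with hl | ⟨c, rfl, hc⟩
    · rcases prefix_split hl with hl | ⟨c, rfl, hc⟩
      · obtain ⟨j, hj, rfl⟩ := prefix_rep hl
        refine ⟨by simp, fun h => ?_⟩
        simp at h
        subst h
        simpa using IsInnerWord.nil
      · obtain ⟨j, hj, rfl⟩ := prefix_rep hc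
        refine ⟨by simpa using hj, fun h => ?_⟩
        simp at h
        subst h
        simpa using IsInnerWord.peak hk IsInnerWord.nil
    · have := ih c hc
      refine ⟨by simp; omega, fun h => .peak hk (this.2 (by simpa using h))⟩

lemma dword_prefix {q : List Step} (h : IsDWord q) : ∀ l, l <+: q →
    posX l ≤ posY l ∧ (posX l = posY l → IsDWord l) ∧
    (posX l + 1 = posY l → ∃ w r, IsDWord w ∧ IsInnerWord r ∧ l = w ++ Step.N :: r) := by
  induction h with
  | nil => intro l hl; simp at hl; subst hl; simp [IsDWord.nil]
  | dcons _ ih =>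
    intro l hl
    rcases List.prefix_cons_iff.1 hl with rfl | ⟨t, rfl, ht⟩
    · simp [IsDWord.nil]
    · obtain ⟨h1, h2, h3⟩ := ih t ht
      refine ⟨by simp; omega, fun h => .dcons (h2 (by simpa using h)), fun h => ?_⟩
      obtain ⟨w, r, hw, hr, rfl⟩ := h3 (by simpa using h)
      exact ⟨_, r, .dcons hw, hr, rfl⟩
  | @block q p hq _ ih =>
    intro l hl
    rcases List.prefix_cons_iff.1 hl with rfl | ⟨t, rfl, ht⟩
    · simp [IsDWord.nil]
    rcases prefix_split ht with hl | ⟨c, rfl, hc⟩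
    · have := inner_prefix hq t hl
      refine ⟨by simp; omega, fun h => by simp at h; omega, fun h => ?_⟩
      exact ⟨[], t, .nil, this.2 (by simpa using h), rfl⟩
    · have hb := inner_bal hq
      rcases List.prefix_cons_iff.1 hc with rfl | ⟨t, rfl, ht2⟩
      · refine ⟨by simp; omega, fun h => by simp at h; omega, fun h => ?_⟩
        exact ⟨[], q, .nil, hq, by simp⟩
      · obtain ⟨h1, h2, h3⟩ := ih t ht2
        refine ⟨by simp; omega, fun h => .block hq (h2 (by simp at h; omega)), fun h => ?_⟩
        obtain ⟨w, r, hw, hr, rfl⟩ := h3 (by simp at h; omega)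
        exact ⟨_, r, .block hq hw, hr, by simp⟩

lemma memCalD_of_prefix {l w : List Step} (hw : IsDWord w) (h : l <+: w) : MemCalD l :=
  ⟨posX w, w, h, hw, fun q hq => (dword_prefix hw q hq).1, rfl, (dword_bal hw).symm⟩

lemma memCalD_zero {l : List Step} (h : posX l = posY l) : MemCalD l ↔ IsDWord l :=
  ⟨fun ⟨_, _, hq, hd, _⟩ => (dword_prefix hd l hq).2.1 h,
    fun hl => memCalD_of_prefix hl (List.prefix_refl l)⟩

lemma memCalD_one {l : List Step} (h : posX l + 1 = posY l) : MemCalD l ↔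
    ∃ w r, IsDWord w ∧ IsInnerWord r ∧ l = w ++ Step.N :: r := by
  refine ⟨fun ⟨_, _, hq, hd, _⟩ => (dword_prefix hd l hq).2.2 h, ?_⟩
  rintro ⟨w, r, hw, hr, rfl⟩
  refine memCalD_of_prefix (dword_append hw (.block hr .nil)) ⟨[Step.E], by simp⟩

lemma inner_snoc {q : List Step} (h : IsInnerWord q) : q = [] ∨
    (∃ r, IsInnerWord r ∧ q = r ++ [Step.D]) ∨
    (∃ r k, IsInnerWord r ∧ 0 < k ∧
      q = r ++ (List.replicate k Step.N ++ List.replicate k Step.E)) := by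
  induction h with
  | nil => simp
  | dcons _ ih =>
    right
    rcases ih with rfl | ⟨r, hr, rfl⟩ | ⟨r, k, hr, hk, rfl⟩
    · exact Or.inl ⟨[], .nil, rfl⟩
    · exact Or.inl ⟨_, .dcons hr, rfl⟩
    · exact Or.inr ⟨_, k, .dcons hr, hk, rfl⟩
  | @peak j p hj _ ih =>
    right
    rcases ih with rfl | ⟨r, hr, rfl⟩ | ⟨r, k, hr, hk, rfl⟩
    · exact Or.inr ⟨[], j, .nil, hj, by simp⟩
    · exact Or.inl ⟨_, .peak hj hr, by simp⟩
    · exact Or.inr ⟨_, k, .peak hj hr, hk, by simp⟩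

lemma dword_snoc {q : List Step} (h : IsDWord q) : q = [] ∨
    (∃ r, IsDWord r ∧ q = r ++ [Step.D]) ∨
    (∃ r s, IsDWord r ∧ IsInnerWord s ∧ q = r ++ Step.N :: s ++ [Step.E]) := by
  induction h with
  | nil => simp
  | dcons _ ih =>
    right
    rcases ih with rfl | ⟨r, hr, rfl⟩ | ⟨r, k, hr, hk, rfl⟩
    · exact Or.inl ⟨[], .nil, rfl⟩
    · exact Or.inl ⟨_, .dcons hr, rfl⟩
    · exact Or.inr ⟨_, k, .dcons hr, hk, rfl⟩
  | @block j p hj _ ih =>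
    right
    rcases ih with rfl | ⟨r, hr, rfl⟩ | ⟨r, k, hr, hk, rfl⟩
    · exact Or.inr ⟨[], j, .nil, hj, by simp⟩
    · exact Or.inl ⟨_, .block hj hr, by simp⟩
    · exact Or.inr ⟨_, k, .block hj hr, hk, by simp⟩

lemma featureless_prefix {p s : List Step} (h : Featureless (p ++ s)) : Featureless p := by
  intro t
  refine ⟨?_, ?_⟩
  · rintro ⟨ht, q, r, rfl, h1, h2⟩
    exact (h t).1 ⟨ht, q, r ++ s, by simp, h1, h2⟩
  · rintro ⟨ht, q, r, rfl, h1, h2⟩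
    exact (h t).2 ⟨ht, q, r ++ s, by simp, h1, h2⟩

lemma featureless_snoc {p : List Step} {x : Step} (h : Featureless p)
    (hD : x = Step.D → posX p + 1 ≠ posY p)
    (hN : x = Step.N → ∀ q, p = q ++ [Step.E] → posX p ≠ posY p) :
    Featureless (p ++ [x]) := by
  intro t
  refine ⟨?_, ?_⟩
  · rintro ⟨ht, q, r, he, h1, h2⟩
    rcases List.eq_nil_or_concat r with rfl | ⟨r, y, rfl⟩
    · obtain ⟨rfl, hx⟩ := List.append_inj' he rfl
      simp at hx
      exact hD hx (by omega)
    · have he' : p ++ [x] = (q ++ Step.D :: r) ++ [y] := by simpa using he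
      obtain ⟨rfl, hx⟩ := List.append_inj' he' rfl
      exact (h t).1 ⟨ht, q, r, rfl, h1, h2⟩
  · rintro ⟨ht, q, r, he, h1, h2⟩
    rcases List.eq_nil_or_concat r with rfl | ⟨r, y, rfl⟩
    · have he' : p ++ [x] = (q ++ [Step.E]) ++ [Step.N] := by simpa using he
      obtain ⟨rfl, hx⟩ := List.append_inj' he' rfl
      simp at hx
      exact hN hx q rfl (by simp; omega)
    · have he' : p ++ [x] = (q ++ Step.E :: Step.N :: r) ++ [y] := by simpa using he
      obtain ⟨rfl, hx⟩ := List.append_inj' he' rfl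
      exact (h t).2 ⟨ht, q, r, rfl, h1, h2⟩

lemma featureless_nil : Featureless [] := by
  intro t
  refine ⟨?_, ?_⟩ <;> · rintro ⟨ht, q, r, he, h1, h2⟩; simp at he

lemma featureless_repN {p : List Step} (h : Featureless p) (hp : posX p < posY p) (k : ℕ) :
    Featureless (p ++ List.replicate k Step.N) := by
  induction k with
  | zero => simpa
  | succ k ih =>
    rw [List.replicate_succ', ← List.append_assoc]
    refine featureless_snoc ih (by simp) ?_
    intro _ q _
    simp; omega

lemma featureless_repE {p : List Step} (h : Featureless p) (k : ℕ) :
    Featureless (p ++ List.replicate k Step.E) := by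
  induction k with
  | zero => simpa
  | succ k ih =>
    rw [List.replicate_succ', ← List.append_assoc]
    exact featureless_snoc ih (by simp) (by simp)

/-- The set counted by `dSeq`. -/
def dSet (i : ℕ) : Set (List Step) :=
  {p : List Step | MemCalD p ∧ Featureless p ∧ posX p + 1 = i ∧ posY p = i}

/-- The set counted by `cSeq`. -/
def cSet (i : ℕ) : Set (List Step) :=
  {p : List Step | MemCalD p ∧ Featureless p ∧ posX p = i ∧ posY p = i}

/-- The word `N^k E^k`. -/
def pk (k : ℕ) : List Step := List.replicate k Step.N ++ List.replicate k Step.E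

instance : Finite Step :=
  Finite.of_injective (fun s : Step => match s with | .E => (0 : Fin 3) | .N => 1 | .D => 2)
    (by intro a b; cases a <;> cases b <;> simp)

lemma dSet_finite (i : ℕ) : (dSet i).Finite :=
  (List.finite_length_le Step (2 * i)).subset fun p hp => by
    have := length_le_pos p
    obtain ⟨_, _, h1, h2⟩ := hp
    simp only [Set.mem_setOf_eq]; omega

lemma cSet_finite (i : ℕ) : (cSet i).Finite :=
  (List.finite_length_le Step (2 * i)).subset fun p hp => by
    have := length_le_pos p
    obtain ⟨_, _, h1, h2⟩ := hp
    simp only [Set.mem_setOf_eq]; omega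

lemma mem_dSet_cases {i : ℕ} {p : List Step} (hp : p ∈ dSet i) :
    (i = 1 ∧ p = [Step.N]) ∨ (2 ≤ i ∧ ∃ w ∈ cSet (i - 2), p = w ++ [Step.D, Step.N]) ∨
    (∃ j, 1 ≤ j ∧ j < i ∧ ∃ w ∈ dSet j, p = w ++ pk (i - j)) := by
  obtain ⟨hm, hf, hx, hy⟩ := hp
  obtain ⟨w, r, hw, hr, rfl⟩ := (memCalD_one (by omega)).1 hm
  have hbw := dword_bal hw
  rcases inner_snoc hr with rfl | ⟨r, hr', rfl⟩ | ⟨r, k, hr', hk, rfl⟩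
  · rcases dword_snoc hw with rfl | ⟨v, hv, rfl⟩ | ⟨v, s, hv, hs, rfl⟩
    · left; simp at hx; simp [hx]
    · right; left
      have hb := dword_bal hv
      simp at hx hy
      refine ⟨by omega, v, ⟨(memCalD_zero hb).2 hv, ?_, by omega, by omega⟩, by simp⟩
      rw [List.append_assoc] at hf
      exact featureless_prefix hf
    · exfalso
      have hb := dword_bal hv
      have hbs := inner_bal hs
      refine (hf (posY (v ++ Step.N :: s))).2 ⟨by simp; omega, v ++ Step.N :: s, [], by simp, ?_, rfl⟩
      simp; omega
  · exfalso
    have hb := inner_bal hr'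
    refine (hf (posY (w ++ Step.N :: r))).1 ⟨by simp; omega, w ++ Step.N :: r, [], by simp, ?_, rfl⟩
    simp; omega
  · right; right
    have hb := inner_bal hr'
    have hf' : Featureless (w ++ Step.N :: r) := by
      apply featureless_prefix (s := pk k); simpa [pk] using hf
    simp at hx hy
    refine ⟨i - k, by omega, by omega, w ++ Step.N :: r,
      ⟨(memCalD_one (by simp; omega)).2 ⟨w, r, hw, hr', rfl⟩, hf', by simp; omega, by simp; omega⟩, ?_⟩
    have : i - (i - k) = k := by omega
    simp [this, pk]

lemma N_mem : [Step.N] ∈ dSet 1 :=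
  ⟨(memCalD_one (by simp)).2 ⟨[], [], .nil, .nil, rfl⟩,
    featureless_snoc (p := []) featureless_nil (by simp) (by simp), by simp, by simp⟩

lemma DN_mem {i : ℕ} {w : List Step} (hw : w ∈ cSet i) :
    w ++ [Step.D, Step.N] ∈ dSet (i + 2) := by
  obtain ⟨hm, hf, hx, hy⟩ := hw
  refine ⟨(memCalD_one (by simp; omega)).2 ⟨w ++ [Step.D], [],
    dword_append ((memCalD_zero (by omega)).1 hm) (.dcons .nil), .nil, by simp⟩, ?_,
    by simp; omega, by simp; omega⟩
  have : w ++ [Step.D, Step.N] = (w ++ [Step.D]) ++ [Step.N] := by simp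
  rw [this]
  refine featureless_snoc (featureless_snoc hf (fun _ => by omega) (by simp)) (by simp) ?_
  intro _ q hq
  have := (List.append_inj' hq rfl).2
  simp at this

lemma pk_mem {j k : ℕ} {w : List Step} (hk : 0 < k) (hw : w ∈ dSet j) :
    w ++ pk k ∈ dSet (j + k) := by
  obtain ⟨hm, hf, hx, hy⟩ := hw
  obtain ⟨v, r, hv, hr, rfl⟩ := (memCalD_one (by omega)).1 hm
  refine ⟨(memCalD_one ?_).2 ⟨v, r ++ pk k, hv, inner_append hr ?_, by simp⟩, ?_, ?_, ?_⟩
  · simp [pk] at *; omega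
  · simpa [pk] using IsInnerWord.peak hk IsInnerWord.nil
  · rw [pk, ← List.append_assoc]
    exact featureless_repE (featureless_repN hf (by omega) k) k
  · simp [pk] at *; omega
  · simp [pk] at *; omega

lemma pk_ne {w v : List Step} {k l : ℕ} (hk : 0 < k) (hkl : k < l) : w ++ pk k ≠ v ++ pk l := by
  intro h
  obtain ⟨a, rfl⟩ : ∃ a, l = (a + 1) + k := ⟨l - k - 1, by omega⟩
  obtain ⟨b, rfl⟩ : ∃ b, k = b + 1 := ⟨k - 1, by omega⟩
  have h2 : (w ++ List.replicate (b+1) Step.N) ++ List.replicate (b+1) Step.E =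
      (v ++ List.replicate (a+1+(b+1)) Step.N ++ List.replicate (a+1) Step.E) ++
        List.replicate (b+1) Step.E := by
    simp only [pk] at h
    rw [← List.replicate_append_replicate (n := a + 1) (m := b + 1) (a := Step.E)] at h
    simpa only [List.append_assoc] using h
  have h3 := List.append_cancel_right h2
  rw [List.replicate_succ' (n := b), List.replicate_succ' (n := a) (a := Step.E),
    ← List.append_assoc, ← List.append_assoc] at h3
  have := (List.append_inj' h3 rfl).2
  simp at this

lemma dSet_eq {i : ℕ} (hi : 2 ≤ i) : dSet i = (fun w => w ++ [Step.D, Step.N]) '' cSet (i - 2) ∪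
    ⋃ j ∈ (Finset.Icc 1 (i - 1) : Set ℕ), (fun w => w ++ pk (i - j)) '' dSet j := by
  ext p
  simp only [Set.mem_union, Set.mem_image, Set.mem_iUnion, Finset.mem_coe, Finset.mem_Icc]
  constructor
  · intro hp
    rcases mem_dSet_cases hp with ⟨h, _⟩ | ⟨_, w, hw, rfl⟩ | ⟨j, h1, h2, w, hw, rfl⟩
    · omega
    · exact Or.inl ⟨w, hw, rfl⟩
    · exact Or.inr ⟨j, ⟨h1, by omega⟩, w, hw, rfl⟩
  · rintro (⟨w, hw, rfl⟩ | ⟨j, ⟨h1, h2⟩, w, hw, rfl⟩)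
    · have := DN_mem hw
      rwa [show i - 2 + 2 = i by omega] at this
    · have := pk_mem (k := i - j) (by omega) hw
      rwa [show j + (i - j) = i by omega] at this

theorem stmt_14 :
    dSeq 1 = 1 ∧
      ∀ i : ℕ, 2 ≤ i → dSeq i = cSeq (i - 2) + ∑ j ∈ Finset.Icc 1 (i - 1), dSeq j := by
  constructor
  · change (dSet 1).ncard = 1
    rw [Set.ncard_eq_one]
    refine ⟨[Step.N], Set.eq_singleton_iff_unique_mem.2 ⟨N_mem, fun p hp => ?_⟩⟩
    rcases mem_dSet_cases hp with ⟨_, h⟩ | ⟨h, _⟩ | ⟨j, h1, h2, _⟩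
    · exact h
    · omega
    · omega
  · intro i hi
    change (dSet i).ncard = (cSet (i - 2)).ncard + ∑ j ∈ Finset.Icc 1 (i - 1), (dSet j).ncard
    have hfin : ∀ j ∈ (Finset.Icc 1 (i - 1) : Set ℕ),
        ((fun w => w ++ pk (i - j)) '' dSet j).Finite := fun j _ => (dSet_finite j).image _
    rw [dSet_eq hi, Set.ncard_union_eq ?_ ((cSet_finite _).image _)
      ((Finset.finite_toSet _).biUnion hfin)]
    · congr 1
      · exact Set.ncard_image_of_injective _ (List.append_left_injective _)
      · rw [Set.Finite.ncard_biUnion (Finset.finite_toSet _) hfin, finsum_mem_coe_finset]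
        · exact Finset.sum_congr rfl fun j _ =>
            Set.ncard_image_of_injective _ (List.append_left_injective _)
        · intro a ha b hb hab
          simp only [Finset.mem_coe, Finset.mem_Icc] at ha hb
          refine Set.disjoint_left.2 ?_
          rintro _ ⟨w, hw, rfl⟩ ⟨v, hv, h⟩
          rcases Nat.lt_or_gt_of_ne hab with h' | h'
          · exact pk_ne (by omega) (by omega) h
          · exact pk_ne (by omega) (by omega) h.symm
    · refine Set.disjoint_left.2 ?_
      rintro _ ⟨w, hw, rfl⟩ h
      simp only [Set.mem_iUnion, Finset.mem_coe, Finset.mem_Icc, Set.mem_image] at h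
      obtain ⟨j, ⟨h1, h2⟩, v, hv, h⟩ := h
      obtain ⟨k, hk⟩ : ∃ k, i - j = k + 1 := ⟨i - j - 1, by omega⟩
      rw [hk, pk, List.replicate_succ' (n := k) (a := Step.E), ← List.append_assoc,
        ← List.append_assoc, show w ++ [Step.D, Step.N] = (w ++ [Step.D]) ++ [Step.N] by simp] at h
      have := (List.append_inj' h rfl).2
      simp at this
end

section
/- The sequence d satisfies d_0 = 0, d_1 = 1, and d_{k+1} = 2 d_k + d_{k−1} for all k ≥ 1 (so the d_i are Pell numbers), where d_i is the number of featureless Schröder prefixes in 𝒟 terminating at (i−1,i). -/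
inductive PW : Bool → ℕ → List Step → Prop
  | n {n : ℕ} {w : List Step} : PW true n w → PW false (n + 1) (Step.N :: w)
  | d {n : ℕ} {w : List Step} : PW false n w → PW false (n + 1) (Step.D :: w)
  | nil : PW true 0 []
  | pk {n : ℕ} {w : List Step} (k : ℕ) : PW true n w →
      PW true (n + k + 1) (List.replicate (k + 1) Step.N ++ (List.replicate (k + 1) Step.E ++ w))
  | ed {n : ℕ} {w : List Step} : PW false n w → PW true (n + 1) (Step.E :: Step.D :: w)

def gd : ℤ → List Step → Prop
  | _, [] => True
  | h, Step.D :: r => h ≠ 1 ∧ gd h r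
  | h, Step.N :: r => gd (h + 1) r
  | h, Step.E :: r => ¬ (h = 1 ∧ ∃ s, r = Step.N :: s) ∧ gd (h - 1) r

theorem gd_iff (p : List Step) : ∀ h : ℤ, gd h p ↔
    ∀ q r : List Step, (p = q ++ Step.D :: r → h + posY q ≠ posX q + 1) ∧
      (p = q ++ Step.E :: Step.N :: r → h + posY q ≠ posX q + 1) := by
  induction p with
  | nil => intro h; simp [gd]
  | cons a p ih =>
    intro h
    constructor
    · intro hg q r
      rcases q with _ | ⟨b, q⟩
      · cases a <;> simp [gd, posX, posY] at hg ⊢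
        · intro hp; intro h1; exact hg.1 h1 _ hp
        · intro _; exact hg.1
      · have : ∀ h', gd h' p → (h' + posY q = posX q + 1 ↔ h + posY (b :: q) = posX (b :: q) + 1 ) →
          ((a :: p = b :: q ++ Step.D :: r → h + posY (b :: q) ≠ posX (b :: q) + 1) ∧
          (a :: p = b :: q ++ Step.E :: Step.N :: r → h + posY (b :: q) ≠ posX (b :: q) + 1)) := by
          intro h' hh he
          have := (ih h').1 hh q r
          simp only [List.cons_append, List.cons.injEq]
          exact ⟨fun e => by rw [Ne, ← he]; exact this.1 e.2, fun e => by rw [Ne, ← he]; exact this.2 e.2⟩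
        by_cases hab : a = b
        · subst hab
          cases a
          · exact this (h - 1) hg.2 (by simp [posX, posY]; omega)
          · exact this (h + 1) hg (by simp [posX, posY]; omega)
          · exact this h hg.2 (by simp [posX, posY]; omega)
        · simp [hab]
    · intro H
      have H' : ∀ h' : ℤ, (∀ q : List Step, h' + posY q = posX q + 1 → h + posY (a :: q) = posX (a :: q) + 1) → gd h' p := by
        intro h' he
        refine (ih h').2 fun q r => ⟨fun e hh => (H (a :: q) r).1 (by simp [e]) (he _ hh),
          fun e hh => (H (a :: q) r).2 (by simp [e]) (he _ hh)⟩
      cases a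
      · refine ⟨?_, H' _ ?_⟩
        · rintro ⟨rfl, s, rfl⟩
          exact (H [] s).2 rfl (by simp [posX, posY])
        · intro q; simp [posX, posY]; omega
      · refine H' _ ?_
        intro q; simp [posX, posY]; omega
      · refine ⟨?_, H' _ ?_⟩
        · rintro rfl
          exact (H [] p).1 rfl (by simp [posX, posY])
        · intro q; simp [posX, posY]; omega

theorem featureless_iff (p : List Step) : Featureless p ↔ gd 0 p := by
  rw [gd_iff]
  constructor
  · intro H q r
    refine ⟨fun e h => (H (posY q)).1 ⟨by omega, q, r, e, by omega, rfl⟩,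
      fun e h => (H (posY q)).2 ⟨by omega, q, r, e, by omega, rfl⟩⟩
  · rintro H t
    constructor
    · rintro ⟨h1, q, r, e, hx, hy⟩
      exact (H q r).1 e (by omega)
    · rintro ⟨h1, q, r, e, hx, hy⟩
      exact (H q r).2 e (by omega)

theorem gd_N (k : ℕ) (w : List Step) : ∀ h : ℤ, gd h (List.replicate k Step.N ++ w) ↔ gd (h + k) w := by
  induction k with
  | zero => simp
  | succ k ih => 
    intro h
    simp only [List.replicate_succ, List.cons_append, gd, ih]
    push_cast
    rw [show h + 1 + (k : ℤ) = h + (k + 1) by ring]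

theorem gd_E (k : ℕ) (w : List Step) : gd (1 + k) (List.replicate k Step.E ++ w) ↔ gd 1 w := by
  induction k with
  | zero => simp
  | succ k ih => 
    simp only [List.replicate_succ, List.cons_append, gd]
    push_cast
    rw [show 1 + ((k : ℤ) + 1) - 1 = 1 + k by ring, ih]
    constructor
    · exact fun h => h.2
    · intro h; refine ⟨?_, h⟩
      rintro ⟨h1, _⟩; omega

theorem gd_pk (k : ℕ) (w : List Step) :
    gd 1 (List.replicate k Step.N ++ (List.replicate k Step.E ++ w)) ↔ gd 1 w := by
  rw [gd_N, gd_E]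

theorem PW.gd {b n w} (h : PW b n w) : gd (if b then 1 else 0) w := by
  induction h with
  | n _ ih => simpa [_root_.gd] using ih
  | d _ ih => simpa [_root_.gd] using ih
  | nil => simp [_root_.gd]
  | pk k _ ih => simpa [gd_pk] using ih
  | ed _ ih => simpa [_root_.gd] using ih

theorem PW.pos {b n w} (h : PW b n w) : posY w = n ∧ posX w + (if b then 0 else 1) = n := by
  induction h with
  | nil => simp [posX, posY]
  | pk k _ ih => 
    simp [posX, posY, List.count_replicate] at ih ⊢
    omega
  | _ _ ih => 
    simp [posX, posY] at ih ⊢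
    omega

theorem PW.word {b n w} (h : PW b n w) : (b = false → IsDWord (w ++ [Step.E])) ∧
    (b = true → ∃ q s, IsInnerWord q ∧ IsDWord s ∧ w ++ [Step.E] = q ++ Step.E :: s) := by
  induction h with
  | n _ ih => 
    refine ⟨fun _ => ?_, by simp⟩
    obtain ⟨q, s, hq, hs, e⟩ := ih.2 rfl
    rw [List.cons_append, e]
    exact .block hq hs
  | d _ ih => exact ⟨fun _ => .dcons (ih.1 rfl), by simp⟩
  | nil => exact ⟨by simp, fun _ => ⟨[], [], .nil, .nil, rfl⟩⟩
  | pk k _ ih => 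
    refine ⟨by simp, fun _ => ?_⟩
    obtain ⟨q, s, hq, hs, e⟩ := ih.2 rfl
    refine ⟨_, s, .peak (Nat.succ_pos k) hq, hs, ?_⟩
    simp only [List.append_assoc, e]
  | ed _ ih => 
    exact ⟨by simp, fun _ => ⟨[], _, .nil, .dcons (ih.1 rfl), rfl⟩⟩

def sch : ℤ → List Step → Prop := fun h p => ∀ q, q <+: p → (posX q : ℤ) ≤ posY q + h

theorem sch_cons_D {h p} (H : sch h p) (h0 : 0 ≤ h) : sch h (Step.D :: p) := by
  intro q hq
  rcases List.prefix_cons_iff.1 hq with rfl | ⟨t, rfl, ht⟩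
  · simpa [posX, posY] using h0
  · have := H t ht
    simp [posX, posY] at this ⊢; omega
theorem sch_cons_N {h p} (H : sch (h+1) p) (h0 : 0 ≤ h) : sch h (Step.N :: p) := by
  intro q hq
  rcases List.prefix_cons_iff.1 hq with rfl | ⟨t, rfl, ht⟩
  · simpa [posX, posY] using h0
  · have := H t ht
    simp [posX, posY] at this ⊢; omega
theorem sch_cons_E {h p} (H : sch (h-1) p) (h0 : 0 ≤ h) : sch h (Step.E :: p) := by
  intro q hq
  rcases List.prefix_cons_iff.1 hq with rfl | ⟨t, rfl, ht⟩
  · simpa [posX, posY] using h0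
  · have := H t ht
    simp [posX, posY] at this ⊢; omega
theorem sch_N (k : ℕ) (w : List Step) : ∀ h : ℤ, 0 ≤ h → sch (h + k) w →
    sch h (List.replicate k Step.N ++ w) := by
  induction k with
  | zero => intro h _; simp
  | succ k ih => 
    intro h h0 H
    refine sch_cons_N (ih _ (by omega) ?_) h0
    push_cast at H
    rwa [show h + 1 + (k : ℤ) = h + (k + 1) by ring]
theorem sch_E (k : ℕ) (w : List Step) : ∀ h : ℤ, 0 ≤ h → sch h w →
    sch (h + k) (List.replicate k Step.E ++ w) := by
  induction k with
  | zero => intro h _; simp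
  | succ k ih => 
    intro h h0 H
    refine sch_cons_E ?_ (by omega)
    push_cast 
    rw [show h + ((k : ℤ) + 1) - 1 = h + k by ring]
    exact ih h h0 H

theorem inner_sch {q} (hq : IsInnerWord q) : ∀ w h, 0 ≤ h → sch h w → sch h (q ++ w) := by
  induction hq with
  | nil => intro w h _ H; exact H
  | dcons _ ih => intro w h h0 H; exact sch_cons_D (ih w h h0 H) h0
  | @peak k p _ _ ih => 
    intro w h h0 H
    rw [List.append_assoc, List.append_assoc]
    exact sch_N _ _ _ h0 (sch_E _ _ _ h0 (ih w h h0 H))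

theorem dword_sch {q} (hq : IsDWord q) : sch 0 q := by
  induction hq with
  | nil => intro q hq; simp at hq; subst hq; simp [posX, posY]
  | dcons _ ih => exact sch_cons_D ih le_rfl
  | block hi _ ih => 
    exact sch_cons_N (inner_sch hi _ _ (by norm_num) (sch_cons_E (by simpa using ih) (by norm_num))) le_rfl

theorem inner_pos {q} (hq : IsInnerWord q) : posX q = posY q := by
  induction hq with
  | nil => rfl
  | dcons _ ih => simp [posX, posY] at ih ⊢; omega
  | peak _ _ ih => simp [posX, posY, List.count_replicate] at ih ⊢; omega

theorem dword_pos {q} (hq : IsDWord q) : posX q = posY q := by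
  induction hq with
  | nil => rfl
  | dcons _ ih => simp [posX, posY] at ih ⊢; omega
  | block hi _ ih => 
    have := inner_pos hi
    simp [posX, posY] at this ih ⊢; omega

theorem memCalD_iff (p : List Step) : MemCalD p ↔ ∃ q, p <+: q ∧ IsDWord q := by
  constructor
  · rintro ⟨m, q, h, h2⟩; exact ⟨q, h, h2.1⟩
  · rintro ⟨q, h, h2⟩
    refine ⟨_, q, h, h2, fun r hr => ?_, dword_pos h2, rfl⟩
    have := dword_sch h2 r hr
    omega

theorem prefix_append_cases {α : Type} (a b p : List α) (h : p <+: a ++ b) :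
    p <+: a ∨ ∃ t, p = a ++ t ∧ t <+: b := by
  rcases List.prefix_or_prefix_of_prefix h (List.prefix_append a b) with h1 | ⟨t, rfl⟩
  · exact Or.inl h1
  · exact Or.inr ⟨t, rfl, (List.prefix_append_right_inj a).1 h⟩

theorem pk_prefix (k : ℕ) (p w : List Step)
    (h : p <+: List.replicate k Step.N ++ (List.replicate k Step.E ++ w)) (hp : posX p = posY p) :
    p = [] ∨ ∃ t, t <+: w ∧ p = List.replicate k Step.N ++ (List.replicate k Step.E ++ t) := by
  rcases prefix_append_cases _ _ _ h with h | ⟨t, rfl, ht⟩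
  · left
    obtain ⟨_, h2⟩ := List.prefix_replicate_iff.1 h
    rw [h2] at hp
    simp [posX, posY, List.count_replicate] at hp
    exact List.length_eq_zero_iff.1 hp.symm
  · right
    rcases prefix_append_cases _ _ _ ht with h | ⟨t, rfl, ht'⟩
    · obtain ⟨_, h2⟩ := List.prefix_replicate_iff.1 h
      refine ⟨[], List.nil_prefix, ?_⟩
      rw [h2] at hp ⊢
      simp [posX, posY, List.count_replicate] at hp
      simp [hp]
    · exact ⟨t, ht', rfl⟩

theorem inner_back {q s} (hq : IsInnerWord q)
    (hs : ∀ p, p <+: s → gd 0 p → posX p + 1 = posY p → PW false (posY p) p) :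
    ∀ p, p <+: q ++ Step.E :: s → gd 1 p → posX p = posY p → PW true (posY p) p := by
  induction hq with
  | nil => 
    intro p hp hg he
    rcases List.prefix_cons_iff.1 hp with rfl | ⟨t, rfl, ht⟩
    · exact .nil
    · unfold gd at hg
      have h1 : posX t + 1 = posY t := by simp [posX, posY] at he ⊢; omega
      have := hs t ht (by simpa using hg.2) h1
      have e : posY (Step.E :: t) = posY t := by simp [posY]
      rw [e]
      generalize posY t = n at this
      cases this with
      | n h => exact (hg.1 ⟨rfl, _, rfl⟩).elim
      | d h => exact .ed h
  | dcons _ ih => 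
    intro p hp hg he
    rcases List.prefix_cons_iff.1 hp with rfl | ⟨t, rfl, ht⟩
    · exact .nil
    · exact absurd rfl hg.1
  | @peak k q hk _ ih => 
    intro p hp hg he
    rw [List.append_assoc, List.append_assoc] at hp
    rcases pk_prefix _ _ _ hp he with rfl | ⟨t, ht, rfl⟩
    · exact .nil
    · obtain ⟨k, rfl⟩ := Nat.exists_eq_add_of_lt hk
      rw [gd_pk] at hg
      have := PW.pk k (ih t ht hg (by simp [posX, posY, List.count_replicate] at he ⊢; omega))
      convert this using 1
      · simp [posY, List.count_replicate]; omega
      · simp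

theorem dword_back {s} (hs : IsDWord s) :
    ∀ p, p <+: s → gd 0 p → posX p + 1 = posY p → PW false (posY p) p := by
  induction hs with
  | nil => intro p hp; simp at hp; subst hp; simp [posX, posY]
  | dcons _ ih =>
    intro p hp hg he
    rcases List.prefix_cons_iff.1 hp with rfl | ⟨t, rfl, ht⟩
    · simp [posX, posY] at he
    · have := PW.d (ih t ht hg.2 (by simp [posX, posY] at he ⊢; omega))
      convert this using 1
      simp [posY]; omega
  | block hi _ ih =>
    intro p hp hg he
    rcases List.prefix_cons_iff.1 hp with rfl | ⟨t, rfl, ht⟩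
    · simp [posX, posY] at he
    · have := PW.n (inner_back hi ih t ht (by simpa [gd] using hg) (by simp [posX, posY] at he ⊢; omega))
      convert this using 1
      simp [posY]; omega

def XS (n : ℕ) : Set (List Step) := {w | PW false n w}

theorem dSeq_eq (n : ℕ) : dSeq n = (XS n).ncard := by
  unfold dSeq XS
  congr 1
  ext p
  simp only [Set.mem_setOf_eq, memCalD_iff, featureless_iff]
  constructor
  · rintro ⟨⟨q, hp, hq⟩, hg, hx, rfl⟩
    exact dword_back hq p hp hg hx
  · intro h
    exact ⟨⟨_, List.prefix_append _ _, h.word.1 rfl⟩, by simpa using h.gd, by simpa using h.pos.2, h.pos.1⟩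

def gg : ℕ → List Step → List Step
  | j, Step.D :: w => gg (j + 1) w
  | j, Step.N :: w => Step.N :: (List.replicate (j + 1) Step.N ++ (List.replicate (j + 1) Step.E ++ w))
  | _, _ => []

theorem gg_eq (j : ℕ) (v : List Step) : ∀ i, gg i (List.replicate j Step.D ++ Step.N :: v) =
    Step.N :: (List.replicate (i + j + 1) Step.N ++ (List.replicate (i + j + 1) Step.E ++ v)) := by
  induction j with
  | zero => intro i; simp [gg]
  | succ j ih => 
    intro i; simp only [List.replicate_succ (n := j), List.cons_append, gg, ih]
    rw [show i + 1 + j + 1 = i + (j + 1) + 1 by ring]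

theorem XS_rep {n w} (h : PW false n w) : ∃ j m v, PW true m v ∧ n = m + j + 1 ∧
    w = List.replicate j Step.D ++ Step.N :: v := by
  generalize hb : false = b at h
  induction h with
  | n h => exact ⟨0, _, _, h, by simp, rfl⟩
  | d _ ih => 
    obtain ⟨j, m, v, h, rfl, rfl⟩ := ih hb
    exact ⟨j + 1, m, v, h, by ring, rfl⟩
  | _ => cases hb

theorem XS_mk {m v} (h : PW true m v) (j : ℕ) :
    PW false (m + j + 1) (List.replicate j Step.D ++ Step.N :: v) := by
  induction j with
  | zero => exact .n h
  | succ j ih => exact .d ih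

theorem pk_inj (j : ℕ) (v u : List Step) : ∀ i a b,
    List.replicate j Step.N ++ (List.replicate (a + 1) Step.E ++ v) =
    List.replicate i Step.N ++ (List.replicate (b + 1) Step.E ++ u) → j = i := by
  induction j with
  | zero => intro i a b h; cases i <;> simp [List.replicate_succ] at h ⊢
  | succ j ih => 
    intro i a b h
    cases i with
    | zero => simp [List.replicate_succ] at h
    | succ i =>
      have := ih i a b (by simpa [List.replicate_succ] using h)
      omega

theorem gg_inj (n : ℕ) : Set.InjOn (gg 0) (XS n) := by
  intro x hx y hy hxy
  obtain ⟨j, m, v, h, e, rfl⟩ := XS_rep hx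
  obtain ⟨j', m', v', h', e', rfl⟩ := XS_rep hy
  rw [gg_eq, gg_eq] at hxy
  have h1 := List.cons.inj hxy |>.2
  have := pk_inj _ _ _ _ _ _ h1
  obtain rfl : j = j' := by omega
  simp at h1
  rw [h1]

theorem XS_zero : XS 0 = ∅ := by
  ext w; simp only [XS, Set.mem_setOf_eq, Set.mem_empty_iff_false, iff_false]
  intro h; cases h

theorem XS_one : XS 1 = {[Step.N]} := by
  ext w; simp only [XS, Set.mem_setOf_eq, Set.mem_singleton_iff]
  constructor
  · intro h
    cases h with
    | n h => cases h; rfl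
    | d h => cases h
  · rintro rfl; exact .n .nil

theorem XS_succ (n : ℕ) : XS (n + 2) = (List.cons Step.D '' XS (n + 1) ∪ gg 0 '' XS (n + 1)) ∪
    (fun w => Step.N :: Step.E :: Step.D :: w) '' XS n := by
  ext w
  constructor
  · intro h
    generalize hk : n + 2 = k at h
    cases h with
    | d h => 
      obtain rfl := Nat.succ_injective hk
      exact Or.inl (Or.inl ⟨_, h, rfl⟩)
    | n h => 
      obtain rfl := Nat.succ_injective hk
      generalize hk : n + 1 = k at h
      cases h with
      | nil => cases hk
      | pk k h => 
        have := XS_mk h k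
        exact Or.inl (Or.inr ⟨_, this, (gg_eq k _ 0).trans (by rw [zero_add])⟩)
      | ed h =>
        obtain rfl := Nat.succ_injective hk
        exact Or.inr ⟨_, h, rfl⟩
  · rintro ((⟨w, h, rfl⟩ | ⟨w, h, rfl⟩) | ⟨w, h, rfl⟩)
    · exact .d h
    · obtain ⟨j, m, v, h', e, rfl⟩ := XS_rep h
      rw [gg_eq, zero_add]
      have := PW.n (PW.pk j h')
      rwa [← e] at this
    · exact .n (.ed h)

theorem XS_fin (n : ℕ) : (XS n).Finite ∧ (XS (n + 1)).Finite := by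
  induction n with
  | zero => simp [XS_zero, XS_one]
  | succ n ih =>
    refine ⟨ih.2, ?_⟩
    rw [XS_succ]
    exact ((ih.2.image _).union (ih.2.image _)).union (ih.1.image _)

theorem XS_card (n : ℕ) : (XS (n + 2)).ncard = 2 * (XS (n + 1)).ncard + (XS n).ncard := by
  have f1 := (XS_fin n).2
  have f0 := (XS_fin n).1
  rw [XS_succ, Set.ncard_union_eq _ ((f1.image _).union (f1.image _)) (f0.image _),
    Set.ncard_union_eq _ (f1.image _) (f1.image _), Set.ncard_image_of_injOn (gg_inj _),
    Set.ncard_image_of_injective _ (List.cons_injective), Set.ncard_image_of_injective]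
  · ring
  · intro a b h; simpa using h
  · rw [Set.disjoint_left]
    rintro _ ⟨w, h, rfl⟩ ⟨x, hx, e⟩
    obtain ⟨j, m, v, h, e, rfl⟩ := XS_rep hx
    rw [gg_eq] at e
    simp at e
  · rw [Set.disjoint_left]
    rintro _ (⟨w, h, rfl⟩ | ⟨x, hx, rfl⟩) ⟨y, hy, e⟩
    · simp at e
    · obtain ⟨j, m, v, h, e, rfl⟩ := XS_rep hx
      rw [gg_eq] at e
      simp [List.replicate_succ] at e

theorem stmt_15 :
    dSeq 0 = 0 ∧ dSeq 1 = 1 ∧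
      ∀ k : ℕ, 1 ≤ k → dSeq (k + 1) = 2 * dSeq k + dSeq (k - 1) := by
  simp only [dSeq_eq]
  refine ⟨by simp [XS_zero], by simp [XS_one], ?_⟩
  rintro (_ | k) hk
  · omega
  · exact XS_card k
end
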